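/- Fix α ∈ (0,1) and p, q ∈ (0,1)^N with p_1 ≤ p_2 ≤ … ≤ p_N ≤ 1/2 and m(p) > 2, and let M = ⌈m(p)⌉ and k = ⌈m(p)⌉ − ⌊m(p)/2⌋. Let i ∈ {1,…,M} be an index such that there are at least k indices ℓ ∈ {1,…,M} \ {i} with q_ℓ ≥ q_i, and let j ∈ {1,…,M} \ {i}. Then α · p_i · ∏_{ℓ ∈ {1,…,M} \ {i,j}} (1 − p_ℓ) + (1 − α) · q_i · ∏_{ℓ ∈ {1,…,M} \ {i,j}} (1 − q_ℓ) ≤ 1/m(p). (This quantity is the probability, in the Bernoulli HCB, that under the intervention do(X_j = 0) the arm vector X lies in the set 𝒳_i* = { x ∈ {0,1}^N : x_i = 1 and x_ℓ = 0 for all ℓ ∈ {1,…,M} \ {i} }.) -/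

import Mathlib

open Finset

/-- For `v : Fin N → ℝ` and `s : ℝ`, the index set
`I_s(v) = { n : min (v n) (1 - v n) < 1/s }`. -/
noncomputable def Ival {N : ℕ} (v : Fin N → ℝ) (s : ℝ) : Finset (Fin N) :=
  Finset.univ.filter (fun n => min (v n) (1 - v n) < 1 / s)

/-- `m(v) = min { s > 0 : s ≥ |I_s(v)| }` (the minimum exists; we use `sInf`). -/
noncomputable def mVal {N : ℕ} (v : Fin N → ℝ) : ℝ :=
  sInf {s : ℝ | 0 < s ∧ ((Ival v s).card : ℝ) ≤ s}

theorem one_add_pow_ge_quadratic {t : ℝ} (ht : 0 ≤ t) (n : ℕ) :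
    1 + n * t + n * (n - 1) / 2 * t ^ 2 ≤ (1 + t) ^ n := by
  induction n with
  | zero => simp
  | succ n ih =>
    have hn : (0 : ℝ) ≤ n * (n - 1) := by
      rcases n with _ | n
      · simp
      · push_cast
        rw [add_sub_cancel_right]
        positivity
    have h := mul_le_mul_of_nonneg_right ih (by linarith : 0 ≤ 1 + t)
    have h3 := mul_nonneg hn (pow_nonneg ht 3)
    rw [pow_succ (1 + t)]
    push_cast
    nlinarith

theorem two_mul_mul_le_one_add_pow {t : ℝ} (ht : 0 ≤ t) {n : ℕ} (hn : 2 ≤ n) :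
    2 * n * t ≤ (1 + t) ^ n := by
  have h := one_add_pow_ge_quadratic ht n
  have hn' : (2 : ℝ) ≤ n := by exact_mod_cast hn
  nlinarith [sq_nonneg (n * t - 2), mul_nonneg (mul_nonneg (by linarith : (0 : ℝ) ≤ n)
    (by linarith : (0 : ℝ) ≤ n - 2)) (sq_nonneg t)]

theorem mul_one_sub_pow_le {x : ℝ} (hx : x ∈ Set.Ioo (0 : ℝ) 1) {r : ℕ} (hr : 1 ≤ r) :
    x * (1 - x) ^ r ≤ 1 / (2 * (r + 1)) := by
  have hy : 0 < 1 - x := sub_pos.2 hx.2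
  have h := two_mul_mul_le_one_add_pow (div_nonneg hx.1.le hy.le) (Nat.succ_le_succ hr)
  have h1 : 1 + x / (1 - x) = 1 / (1 - x) := by
    field_simp
    ring
  rw [h1, div_pow, one_pow, le_div_iff₀ (by positivity), Nat.succ_eq_add_one, pow_succ] at h
  rw [le_div_iff₀ (by positivity)]
  push_cast at h
  calc x * (1 - x) ^ r * (2 * (r + 1))
      = 2 * (r + 1) * (x / (1 - x)) * ((1 - x) ^ r * (1 - x)) := by field_simp
    _ ≤ 1 := h

/-- If `p` is sorted with values in `(0, 1/2]`, the `⌈m(p)⌉` smallest entries are at most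
`1 / m(p)`. -/
theorem le_one_div_mVal {N : ℕ} {p : Fin N → ℝ} (hmono : Monotone p)
    (hhalf : ∀ j, p j ≤ 1 / 2) (hm : 0 < mVal p) {i : Fin N} (hpi : 0 < p i)
    (hi : (i : ℝ) < mVal p) : p i ≤ 1 / mVal p := by
  by_contra! hlt
  have hlt' : 1 / p i < mVal p := by
    rwa [div_lt_comm₀ hpi hm]
  obtain ⟨s, hs, hsm⟩ := exists_between (max_lt hlt' hi)
  obtain ⟨hs1, hs2⟩ := max_lt_iff.1 hs
  have hs0 : 0 < s := (one_div_pos.2 hpi).trans hs1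
  have hsub : Ival p s ⊆ Finset.Iio i := by
    intro n hn
    simp only [Ival, mem_filter, mem_univ, true_and] at hn
    rw [min_eq_left (by linarith [hhalf n])] at hn
    rw [Finset.mem_Iio]
    by_contra! hle
    exact absurd (hn.trans ((div_lt_comm₀ hs0 hpi).2 hs1)) (hmono hle).not_gt
  have hcard : ((Ival p s).card : ℝ) ≤ i := by
    have h := Finset.card_le_card hsub
    rw [Fin.card_Iio] at h
    exact_mod_cast h
  have hle : mVal p ≤ s := csInf_le ⟨0, fun _ h => h.1.le⟩ ⟨hs0, hcard.trans hs2.le⟩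
  exact hle.not_gt hsm

theorem prod_one_sub_le_pow {ι : Type*} {q : ι → ℝ}
    (hq : ∀ j, q j ∈ Set.Ioo (0 : ℝ) 1) {x : ℝ} (hx : x ∈ Set.Ioo (0 : ℝ) 1)
    {S T : Finset ι} (hTS : T ⊆ S) (hT : ∀ l ∈ T, x ≤ q l) {r : ℕ} (hr : r ≤ T.card) :
    ∏ l ∈ S, (1 - q l) ≤ (1 - x) ^ r := by
  have hx0 : 0 ≤ 1 - x := (sub_pos.2 hx.2).le
  calc ∏ l ∈ S, (1 - q l) ≤ ∏ l ∈ T, (1 - q l) :=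
        Finset.prod_le_prod_of_subset_of_le_one hTS
          (fun l _ => (sub_pos.2 (hq l).2).le) (fun l _ _ => by linarith [(hq l).1])
    _ ≤ ∏ _l ∈ T, (1 - x) :=
        Finset.prod_le_prod (fun l _ => (sub_pos.2 (hq l).2).le)
          (fun l hl => by linarith [hT l hl])
    _ = (1 - x) ^ T.card := by simp
    _ ≤ (1 - x) ^ r := pow_le_pow_of_le_one hx0 (by linarith [hx.1]) hr

/-- for sorted `p` with `p_N ≤ 1/2` and `m(p) > 2`, with
`M = ⌈m(p)⌉`, `k = ⌈m(p)⌉ - ⌊m(p)/2⌋`, an index `i` among the first `M`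
indices such that at least `k` indices `ℓ < M`, `ℓ ≠ i` satisfy `q_ℓ ≥ q_i`,
and another index `j < M`, `j ≠ i`, one has
`α p_i ∏_{ℓ < M, ℓ ∉ {i,j}} (1 - p_ℓ) + (1-α) q_i ∏_{ℓ < M, ℓ ∉ {i,j}} (1 - q_ℓ) ≤ 1/m(p)`.
(Indices are 0-based: `ℓ ∈ {1,…,M}` becomes `(ℓ : ℕ) < M`.) -/
theorem stmt13 {N : ℕ} (α : ℝ) (hα : α ∈ Set.Ioo (0 : ℝ) 1)
    (p q : Fin N → ℝ) (hp : ∀ j, p j ∈ Set.Ioo (0 : ℝ) 1)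
    (hq : ∀ j, q j ∈ Set.Ioo (0 : ℝ) 1)
    (hmono : Monotone p) (hhalf : ∀ j, p j ≤ 1 / 2) (hm : 2 < mVal p)
    (M : ℕ) (hM : (M : ℤ) = ⌈mVal p⌉)
    (k : ℕ) (hk : (k : ℤ) = ⌈mVal p⌉ - ⌊mVal p / 2⌋)
    (i : Fin N) (hi : (i : ℕ) < M)
    (hcard : k ≤ (univ.filter
      (fun ℓ : Fin N => (ℓ : ℕ) < M ∧ ℓ ≠ i ∧ q i ≤ q ℓ)).card)
    (j : Fin N) (hj : (j : ℕ) < M) (hij : j ≠ i) :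
    α * p i *
        ∏ ℓ ∈ univ.filter (fun ℓ : Fin N => (ℓ : ℕ) < M ∧ ℓ ≠ i ∧ ℓ ≠ j), (1 - p ℓ) +
      (1 - α) * q i *
        ∏ ℓ ∈ univ.filter (fun ℓ : Fin N => (ℓ : ℕ) < M ∧ ℓ ≠ i ∧ ℓ ≠ j), (1 - q ℓ) ≤
      1 / mVal p := by
  have hm0 : 0 < mVal p := by linarith
  have hiM : (i : ℝ) < mVal p := by
    have h : ((i : ℕ) : ℤ) < ⌈mVal p⌉ := by omega
    exact_mod_cast Int.lt_ceil.1 h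
  have hkm : mVal p ≤ 2 * k := by
    have h1 := Int.le_ceil (mVal p)
    have h2 := Int.floor_le (mVal p / 2)
    have h3 : (k : ℝ) = ⌈mVal p⌉ - ⌊mVal p / 2⌋ := by exact_mod_cast hk
    linarith
  have hk2 : 2 ≤ k := by
    have h : (1 : ℝ) < k := by linarith
    exact_mod_cast h
  obtain ⟨r, rfl⟩ : ∃ r, k = r + 1 := ⟨k - 1, by omega⟩
  set S := univ.filter (fun ℓ : Fin N => (ℓ : ℕ) < M ∧ ℓ ≠ i ∧ ℓ ≠ j)
  have hpS : p i * ∏ ℓ ∈ S, (1 - p ℓ) ≤ 1 / mVal p :=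
    (mul_le_of_le_one_right (hp i).1.le (Finset.prod_le_one
      (fun l _ => (sub_pos.2 (hp l).2).le) (fun l _ => by linarith [(hp l).1]))).trans
      (le_one_div_mVal hmono hhalf hm0 (hp i).1 hiM)
  have hqS : q i * ∏ ℓ ∈ S, (1 - q ℓ) ≤ 1 / mVal p := by
    have hprod : ∏ ℓ ∈ S, (1 - q ℓ) ≤ (1 - q i) ^ r := by
      refine prod_one_sub_le_pow hq (hq i)
        (T := (univ.filter (fun ℓ : Fin N => (ℓ : ℕ) < M ∧ ℓ ≠ i ∧ q i ≤ q ℓ)).erase j)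
        (fun l hl => ?_) (fun l hl => ?_) ?_
      · simp only [mem_erase, mem_filter, mem_univ, true_and] at hl
        simp only [S, mem_filter, mem_univ, true_and]
        exact ⟨hl.2.1, hl.2.2.1, hl.1⟩
      · simp only [mem_erase, mem_filter, mem_univ, true_and] at hl
        exact hl.2.2.2
      · exact (Nat.le_sub_of_add_le hcard).trans Finset.pred_card_le_card_erase
    calc q i * ∏ ℓ ∈ S, (1 - q ℓ) ≤ q i * (1 - q i) ^ r :=
          mul_le_mul_of_nonneg_left hprod (hq i).1.le
      _ ≤ 1 / (2 * (r + 1)) := mul_one_sub_pow_le (hq i) (by omega)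
      _ ≤ 1 / mVal p := one_div_le_one_div_of_le hm0 (by exact_mod_cast hkm)
  have hα1 := mul_le_mul_of_nonneg_left hpS hα.1.le
  have hα2 := mul_le_mul_of_nonneg_left hqS (sub_pos.2 hα.2).le
  linarith
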